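/- arXiv:0909.4275 — 2 statements merged into one kernel-verified Lean document; each statement's English description precedes it below -/
import Mathlib

section
/- Let G be a weighted undirected graph on n vertices with weight matrix W and degree matrix D (all degrees positive). The Jacobi iteration matrix H_JAC = D^{-1}W is convergent (i.e., lim_{k→∞} H_JAC^k exists) if and only if no connected component of G is bipartite. -/
open Matrix Filter

/-- A matrix is *convergent* if the limit of its powers exists. -/
def IsConvergent {n : ℕ} (A : Matrix (Fin n) (Fin n) ℝ) : Prop :=
  ∃ P : Matrix (Fin n) (Fin n) ℝ, Tendsto (fun k => A ^ k) atTop (nhds P)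

/-- The connected component of the vertex `v` (in the graph with weight matrix `W`)
is bipartite: there is a two-coloring of the vertices such that every edge of positive
weight inside the component joins two differently colored vertices. -/
def HasBipartiteComponentAt {n : ℕ} (W : Matrix (Fin n) (Fin n) ℝ) (v : Fin n) : Prop :=
  ∃ c : Fin n → Bool, ∀ i j : Fin n,
    Relation.ReflTransGen (fun a b => 0 < W a b) v i → 0 < W i j → c i ≠ c j

/-- A real matrix that is diagonalizable with all eigenvalues in `(-1, 1]` is convergent. -/
theorem isConvergent_of_diagonalizable {n : ℕ} {A P Q : Matrix (Fin n) (Fin n) ℝ} {l : Fin n → ℝ}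
    (hPQ : P * Q = 1) (hA : A = P * diagonal l * Q) (hl : ∀ i, -1 < l i ∧ l i ≤ 1) :
    IsConvergent A := by
  have hQP : Q * P = 1 := mul_eq_one_comm.mp hPQ
  have hpow : ∀ k, A ^ k = P * diagonal (fun i => l i ^ k) * Q := by
    intro k
    induction k with
    | zero => simp [hPQ]
    | succ k ih =>
      calc A ^ (k + 1)
          = P * diagonal (fun i => l i ^ k) * (Q * P) * diagonal l * Q := by
            rw [pow_succ, ih, hA]; simp only [Matrix.mul_assoc]
        _ = P * diagonal (fun i => l i ^ (k + 1)) * Q := by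
            rw [hQP, Matrix.mul_one, Matrix.mul_assoc P, diagonal_mul_diagonal]
            simp only [pow_succ]
  have hlim : ∀ i, ∃ a, Tendsto (fun k => l i ^ k) atTop (nhds a) := by
    intro i
    rcases (hl i).2.lt_or_eq with h | h
    · exact ⟨0, tendsto_pow_atTop_nhds_zero_of_abs_lt_one (abs_lt.mpr ⟨(hl i).1, h⟩)⟩
    · exact ⟨1, by simp [h]⟩
  choose a ha using hlim
  refine ⟨P * diagonal a * Q, ?_⟩
  simp only [hpow]
  have hcont : Continuous fun m : Fin n → ℝ => P * diagonal m * Q := by fun_prop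
  exact (hcont.tendsto a).comp (tendsto_pi_nhds.mpr ha)

/-- For a symmetric matrix `W` and positive `d`, the matrix with entries `W i j / d i` is
diagonalizable over the reals. -/
theorem exists_diagonalization_of_isSymm {n : ℕ} {W : Matrix (Fin n) (Fin n) ℝ} (hW : W.IsSymm)
    {d : Fin n → ℝ} (hd : ∀ i, 0 < d i) :
    ∃ (P Q : Matrix (Fin n) (Fin n) ℝ) (l : Fin n → ℝ), P * Q = 1 ∧
      diagonal (fun i => (d i)⁻¹) * W = P * diagonal l * Q := by
  set E : Matrix (Fin n) (Fin n) ℝ := diagonal (fun i => √(d i)) with hE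
  set F : Matrix (Fin n) (Fin n) ℝ := diagonal (fun i => (√(d i))⁻¹) with hF
  have hs : ∀ i, √(d i) ≠ 0 := fun i => (Real.sqrt_pos.mpr (hd i)).ne'
  have hFE : F * E = 1 := by
    rw [hE, hF, diagonal_mul_diagonal, ← diagonal_one]
    congr 1; ext i; exact inv_mul_cancel₀ (hs i)
  have hFF : F * F = diagonal (fun i => (d i)⁻¹) := by
    rw [hF, diagonal_mul_diagonal]
    congr 1; ext i; rw [← mul_inv, Real.mul_self_sqrt (hd i).le]
  have hS : (F * W * F).IsHermitian := by
    rw [Matrix.IsHermitian, conjTranspose_eq_transpose_of_trivial, transpose_mul, transpose_mul,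
      hW.eq, hF, diagonal_transpose, Matrix.mul_assoc]
  set U : Matrix (Fin n) (Fin n) ℝ := hS.eigenvectorUnitary.val
  have hUU : U * star U = 1 := Unitary.coe_mul_star_self _
  have hspec : F * W * F = U * diagonal hS.eigenvalues * star U := by
    conv_lhs => rw [hS.spectral_theorem, Unitary.conjStarAlgAut_apply]
    rfl
  refine ⟨F * U, star U * E, hS.eigenvalues, ?_, ?_⟩
  · rw [Matrix.mul_assoc, ← Matrix.mul_assoc U, hUU, Matrix.one_mul, hFE]
  · calc diagonal (fun i => (d i)⁻¹) * W = F * (F * W * F) * E := by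
          rw [← hFF]; simp only [Matrix.mul_assoc, hFE, Matrix.mul_one]
      _ = F * (U * diagonal hS.eigenvalues * star U) * E := congrArg (F * · * E) hspec
      _ = F * U * diagonal hS.eigenvalues * (star U * E) := by
          simp only [Matrix.mul_assoc]

section WeightedGraph

variable {n : ℕ} {W : Matrix (Fin n) (Fin n) ℝ} {x : Fin n → ℝ}

/-- The eigenvalues of the random walk on a weighted graph have absolute value at most one. -/
theorem abs_eigenvalue_le_one (hnn : ∀ i j, 0 ≤ W i j) (hdeg : ∀ i, 0 < ∑ j, W i j) {μ : ℝ}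
    (hx : x ≠ 0) (heig : ∀ i, ∑ j, W i j * x j = μ * (∑ j, W i j) * x i) : |μ| ≤ 1 := by
  obtain ⟨u, hu⟩ := Function.ne_iff.mp hx
  have : Nonempty (Fin n) := ⟨u⟩
  obtain ⟨v, hv⟩ := Finite.exists_max fun i => |x i|
  have hpos : 0 < |x v| := (abs_pos.mpr hu).trans_le (hv u)
  have hle : |μ| * ((∑ j, W v j) * |x v|) ≤ 1 * ((∑ j, W v j) * |x v|) := by
    calc |μ| * ((∑ j, W v j) * |x v|) = |∑ j, W v j * x j| := by
          rw [heig, abs_mul, abs_mul, abs_of_pos (hdeg v), mul_assoc]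
      _ ≤ ∑ j, |W v j * x j| := Finset.abs_sum_le_sum_abs _ _
      _ ≤ ∑ j, W v j * |x v| := by
          gcongr with j
          rw [abs_mul, abs_of_nonneg (hnn v j)]
          exact mul_le_mul_of_nonneg_left (hv j) (hnn v j)
      _ = 1 * ((∑ j, W v j) * |x v|) := by rw [one_mul, Finset.sum_mul]
  exact le_of_mul_le_mul_right hle (mul_pos (hdeg v) hpos)

/-- If the random walk on a weighted graph has eigenvalue `-1`, some component is bipartite. -/
theorem exists_hasBipartiteComponentAt_of_eigenvalue_neg_one (hnn : ∀ i j, 0 ≤ W i j)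
    (hx : x ≠ 0) (heig : ∀ i, ∑ j, W i j * x j = -(∑ j, W i j) * x i) :
    ∃ v, HasBipartiteComponentAt W v := by
  obtain ⟨u, hu⟩ := Function.ne_iff.mp hx
  have : Nonempty (Fin n) := ⟨u⟩
  obtain ⟨v, hv⟩ := Finite.exists_max fun i => |x i|
  have hpos : 0 < |x v| := (abs_pos.mpr hu).trans_le (hv u)
  have hflip : ∀ i j, |x i| = |x v| → 0 < W i j → x j = -x i := by
    intro i j hi hij
    have hterm : ∀ j ∈ Finset.univ, 0 ≤ W i j * (x i * x i + x i * x j) := by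
      intro j _
      refine mul_nonneg (hnn i j) ?_
      have h1 : |x i * x j| ≤ x i * x i := by
        rw [abs_mul, ← abs_mul_abs_self (x i)]
        exact mul_le_mul_of_nonneg_left (hi ▸ hv j) (abs_nonneg _)
      linarith [(abs_le.mp h1).1]
    have hsum : ∑ j, W i j * (x i * x i + x i * x j) = 0 := by
      calc ∑ j, W i j * (x i * x i + x i * x j)
          = x i * ((∑ j, W i j) * x i + ∑ j, W i j * x j) := by
            rw [Finset.sum_mul, ← Finset.sum_add_distrib, Finset.mul_sum]
            exact Finset.sum_congr rfl fun j _ => by ring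
        _ = 0 := by rw [heig]; ring
    have hz := (Finset.sum_eq_zero_iff_of_nonneg hterm).mp hsum j (Finset.mem_univ j)
    have hxi : x i ≠ 0 := abs_pos.mp (hi ▸ hpos)
    rw [← mul_add, mul_eq_zero, mul_eq_zero] at hz
    rcases hz with h | h | h
    · exact absurd h hij.ne'
    · exact absurd h hxi
    · linarith
  have habs : ∀ i, Relation.ReflTransGen (fun a b => 0 < W a b) v i → |x i| = |x v| := by
    intro i h
    induction h with
    | refl => rfl
    | tail _ hab ih => rw [hflip _ _ ih hab, abs_neg, ih]
  refine ⟨v, fun i => decide (0 < x i), fun i j hi hij => ?_⟩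
  have hxi : x i ≠ 0 := abs_pos.mp (habs i hi ▸ hpos)
  beta_reduce
  rw [hflip i j (habs i hi) hij]
  rcases hxi.lt_or_gt with h | h <;> simp [h, h.not_gt]

/-- A bipartite component yields an eigenvector for the eigenvalue `-1`. -/
theorem HasBipartiteComponentAt.exists_eigenvector (hsymm : W.IsSymm) (hnn : ∀ i j, 0 ≤ W i j)
    {v : Fin n} (hv : HasBipartiteComponentAt W v) :
    ∃ x : Fin n → ℝ, x v ≠ 0 ∧ ∀ i, ∑ j, W i j * x j = -(∑ j, W i j) * x i := by
  classical
  obtain ⟨c, hc⟩ := hv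
  let R : Fin n → Prop := Relation.ReflTransGen (fun a b => 0 < W a b) v
  let x : Fin n → ℝ := fun i => if R i then (if c i then 1 else -1) else 0
  refine ⟨x, ?_, fun i => ?_⟩
  · have hR : R v := Relation.ReflTransGen.refl
    simp only [x, hR, if_true]
    split_ifs <;> norm_num
  · rw [neg_mul, Finset.sum_mul, ← Finset.sum_neg_distrib]
    refine Finset.sum_congr rfl fun j _ => ?_
    rcases (hnn i j).eq_or_lt with h | h
    · simp [← h]
    · have hji : 0 < W j i := by rwa [hsymm.apply i j]
      have hR : R i ↔ R j := ⟨fun hi => hi.tail h, fun hj => hj.tail hji⟩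
      by_cases hi : R i
      · have hne := hc i j hi h
        have hj := hR.mp hi
        cases hci : c i <;> cases hcj : c j <;> simp_all [x]
      · have hj : ¬ R j := fun hj => hi (hR.mpr hj)
        simp [x, hi, hj]

end WeightedGraph

/-- A convergent matrix does not have the eigenvalue `-1`. -/
theorem IsConvergent.eq_zero_of_mulVec_eq_neg {n : ℕ} {A : Matrix (Fin n) (Fin n) ℝ}
    (hA : IsConvergent A) {x : Fin n → ℝ} (hx : A *ᵥ x = -x) : x = 0 := by
  obtain ⟨P, hP⟩ := hA
  have hcont : Continuous fun M : Matrix (Fin n) (Fin n) ℝ => M *ᵥ x := by fun_prop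
  have hlim : Tendsto (fun k => A ^ k *ᵥ x) atTop (nhds (P *ᵥ x)) := (hcont.tendsto P).comp hP
  have hstep : ∀ k, A ^ (k + 1) *ᵥ x = -(A ^ k *ᵥ x) := fun k => by
    rw [pow_succ, ← mulVec_mulVec, hx, mulVec_neg]
  have hdouble : ∀ k, A ^ (2 * k) *ᵥ x = x := by
    intro k
    induction k with
    | zero => simp
    | succ k ih => rw [Nat.mul_succ, hstep, hstep, neg_neg, ih]
  have hneg : P *ᵥ x = -(P *ᵥ x) := by
    refine tendsto_nhds_unique ((tendsto_add_atTop_iff_nat 1).mpr hlim) ?_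
    simpa only [hstep] using hlim.neg
  have hfix : P *ᵥ x = x := by
    refine tendsto_nhds_unique
      (hlim.comp (tendsto_id.const_mul_atTop' (two_pos : (0 : ℕ) < 2))) ?_
    simp [Function.comp_def, hdouble]
  rw [hfix] at hneg
  exact self_eq_neg.mp hneg

theorem jacobi_convergent_iff_no_bipartite_component {n : ℕ}
    (W : Matrix (Fin n) (Fin n) ℝ)
    (hsymm : W.IsSymm)
    (hnn : ∀ i j, 0 ≤ W i j)
    (hdiag : ∀ i, W i i = 0)
    (hdeg : ∀ i, 0 < ∑ j, W i j)
    (D : Matrix (Fin n) (Fin n) ℝ) (hD : D = Matrix.diagonal (fun i => ∑ j, W i j))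
    (H : Matrix (Fin n) (Fin n) ℝ) (hH : H = D⁻¹ * W) :
    IsConvergent H ↔ ¬ ∃ v : Fin n, HasBipartiteComponentAt W v := by
  have hDinv : D⁻¹ = diagonal (fun i => (∑ j, W i j)⁻¹) := by
    refine Matrix.inv_eq_right_inv ?_
    rw [hD, diagonal_mul_diagonal, ← diagonal_one]
    congr 1; ext i; exact mul_inv_cancel₀ (hdeg i).ne'
  rw [hDinv] at hH
  have hHx : ∀ (x : Fin n → ℝ) (i : Fin n),
      (H *ᵥ x) i = (∑ j, W i j)⁻¹ * ∑ j, W i j * x j := by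
    intro x i
    rw [hH, ← mulVec_mulVec, mulVec_diagonal]
    rfl
  constructor
  · rintro hconv ⟨v, hv⟩
    obtain ⟨x, hxv, heig⟩ := hv.exists_eigenvector hsymm hnn
    refine hxv (congrFun (hconv.eq_zero_of_mulVec_eq_neg (x := x) ?_) v)
    ext i
    rw [hHx, heig, neg_mul, mul_neg, inv_mul_cancel_left₀ (hdeg i).ne', Pi.neg_apply]
  · intro hbip
    obtain ⟨P, Q, l, hPQ, hdiagz⟩ := exists_diagonalization_of_isSymm hsymm hdeg
    rw [← hH] at hdiagz
    have hQP : Q * P = 1 := mul_eq_one_comm.mp hPQ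
    refine isConvergent_of_diagonalizable hPQ hdiagz fun k => ?_
    have hHP : H * P = P * diagonal l := by
      rw [hdiagz, Matrix.mul_assoc, hQP, Matrix.mul_one]
    have hx : P.col k ≠ 0 := by
      intro h
      have hkk : (Q * P) k k = 1 := by rw [hQP, one_apply_eq]
      have hzero : ∀ i, P i k = 0 := congrFun h
      simp [Matrix.mul_apply, hzero] at hkk
    have heig : ∀ i, ∑ j, W i j * P.col k j = l k * (∑ j, W i j) * P.col k i := by
      intro i
      have h : (H *ᵥ P.col k) i = P i k * l k := by
        rw [← mul_diagonal l P i k, ← hHP]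
        rfl
      rw [hHx, inv_mul_eq_iff_eq_mul₀ (hdeg i).ne'] at h
      rw [h, col_apply]
      ring
    have habs := abs_le.mp (abs_eigenvalue_le_one hnn hdeg hx heig)
    refine ⟨habs.1.lt_of_ne fun h => hbip ?_, habs.2⟩
    refine exists_hasBipartiteComponentAt_of_eigenvalue_neg_one hnn hx fun i => ?_
    rw [heig, ← h, neg_one_mul]
end

section
/- Let G be a connected weighted undirected graph on n vertices with weight matrix W and degree matrix D (positive diagonal). The solutions (μ, x) ∈ ℝ × ℝ^n with x ≠ 0 of the mutually reinforcing model x = μx + D^{-1}Wx are exactly the generalized eigen-pairs of the pencil (L, D) with L = D − W; in particular, the solutions with μ = 0 are exactly the nonzero scalar multiples of the all-ones vector 1, and if G is not complete there exists a solution with 0 < μ ≤ 1 whose vector x is not a scalar multiple of 1. -/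
open Matrix Filter

/-- The graph with weight matrix `W` is connected: any two vertices are joined by a
path of edges of positive weight. -/
def IsConnectedGraph {n : ℕ} (W : Matrix (Fin n) (Fin n) ℝ) : Prop :=
  ∀ i j : Fin n, Relation.ReflTransGen (fun a b => 0 < W a b) i j

/-- If the quadratic form of a real symmetric matrix is nonnegative at `y ≠ 0`, then some
eigenvector with nonnegative eigenvalue is not orthogonal to `y`. -/
theorem Matrix.IsHermitian.exists_nonneg_eigenvalue_dotProduct_ne_zero {ι : Type*} [Fintype ι]
    [DecidableEq ι] {A : Matrix ι ι ℝ} (hA : A.IsHermitian) {y : ι → ℝ} (hy : y ≠ 0)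
    (h : 0 ≤ y ⬝ᵥ A *ᵥ y) :
    ∃ (ν : ℝ) (v : ι → ℝ), 0 ≤ ν ∧ A *ᵥ v = ν • v ∧ v ⬝ᵥ y ≠ 0 := by
  by_contra! hneg
  let b := hA.eigenvectorBasis
  have parseval (z : ι → ℝ) : ∑ k, (y ⬝ᵥ (b k).ofLp) * ((b k).ofLp ⬝ᵥ z) = y ⬝ᵥ z := by
    have := b.sum_inner_mul_inner (WithLp.toLp 2 y) (WithLp.toLp 2 z)
    simpa [EuclideanSpace.inner_eq_star_dotProduct, dotProduct_comm] using this
  have eig (k : ι) : A *ᵥ (b k).ofLp = hA.eigenvalues k • (b k).ofLp :=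
    hA.mulVec_eigenvectorBasis k
  have coord (k : ι) : (b k).ofLp ⬝ᵥ A *ᵥ y = hA.eigenvalues k * ((b k).ofLp ⬝ᵥ y) := by
    have hT : Aᵀ = A := by simpa using hA.eq
    rw [dotProduct_mulVec, ← mulVec_transpose, hT, eig, smul_dotProduct, smul_eq_mul]
  have hterm (k : ι) : (y ⬝ᵥ (b k).ofLp) * ((b k).ofLp ⬝ᵥ A *ᵥ y) ≤ 0 := by
    rw [coord, dotProduct_comm y]
    rcases lt_or_ge (hA.eigenvalues k) 0 with hk | hk
    · nlinarith [sq_nonneg ((b k).ofLp ⬝ᵥ y)]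
    · simp [hneg _ _ hk (eig k)]
  have hzero (k : ι) : (b k).ofLp ⬝ᵥ y = 0 := by
    have hk := (Finset.sum_eq_zero_iff_of_nonpos fun k _ => hterm k).1
      (le_antisymm (Finset.sum_nonpos fun k _ => hterm k) (by rw [parseval]; exact h))
      k (Finset.mem_univ k)
    rw [coord, dotProduct_comm y] at hk
    by_contra hne
    have hν : hA.eigenvalues k = 0 := by simpa [hne] using hk
    exact hne (hneg _ _ hν.ge (eig k))
  exact hy (dotProduct_self_eq_zero.1 (by rw [← parseval y]; simp [hzero]))

/-- The Dirichlet energy of a symmetric weight matrix in terms of its Laplacian. -/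
theorem sum_weight_mul_sub_sq {ι : Type*} [Fintype ι] {W : Matrix ι ι ℝ} (hW : W.IsSymm)
    (x : ι → ℝ) :
    ∑ i, ∑ j, W i j * (x i - x j) ^ 2 =
      2 * ∑ i, x i * ((∑ j, W i j) * x i - ∑ j, W i j * x j) := by
  have hswap : ∑ i, ∑ j, W i j * x j ^ 2 = ∑ i, ∑ j, W i j * x i ^ 2 := by
    rw [Finset.sum_comm]
    simp only [hW.apply]
  have hexp : ∑ i, ∑ j, W i j * (x i - x j) ^ 2 =
      ∑ i, ∑ j, W i j * x i ^ 2 + ∑ i, ∑ j, W i j * x j ^ 2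
        - 2 * ∑ i, ∑ j, x i * (W i j * x j) := by
    simp only [Finset.mul_sum, ← Finset.sum_add_distrib, ← Finset.sum_sub_distrib]
    refine Finset.sum_congr rfl fun i _ => Finset.sum_congr rfl fun j _ => ?_
    ring
  have hlap : ∑ i, x i * ((∑ j, W i j) * x i - ∑ j, W i j * x j) =
      ∑ i, ∑ j, W i j * x i ^ 2 - ∑ i, ∑ j, x i * (W i j * x j) := by
    simp only [mul_sub, Finset.mul_sum, Finset.sum_mul, ← Finset.sum_sub_distrib]
    refine Finset.sum_congr rfl fun i _ => Finset.sum_congr rfl fun j _ => ?_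
    ring
  rw [hexp, hlap, hswap]
  ring

/-- On a connected graph, a vector of zero Dirichlet energy is constant. -/
theorem IsConnectedGraph.eq_of_energy_eq_zero {n : ℕ} {W : Matrix (Fin n) (Fin n) ℝ}
    (hconn : IsConnectedGraph W) (hnn : ∀ i j, 0 ≤ W i j) {x : Fin n → ℝ}
    (h : ∑ i, ∑ j, W i j * (x i - x j) ^ 2 = 0) (i j : Fin n) : x i = x j := by
  have hterm (a b : Fin n) : 0 ≤ W a b * (x a - x b) ^ 2 := mul_nonneg (hnn a b) (sq_nonneg _)
  have hedge (a b : Fin n) (hab : 0 < W a b) : x a = x b := by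
    have ha := (Finset.sum_eq_zero_iff_of_nonneg fun a _ =>
      Finset.sum_nonneg fun b _ => hterm a b).1 h a (Finset.mem_univ a)
    have hb := (Finset.sum_eq_zero_iff_of_nonneg fun b _ => hterm a b).1 ha b (Finset.mem_univ b)
    have : (x a - x b) ^ 2 = 0 := by simpa [hab.ne'] using hb
    exact sub_eq_zero.1 (pow_eq_zero_iff two_ne_zero |>.1 this)
  induction hconn i j with
  | refl => rfl
  | tail _ hab ih => exact ih.trans (hedge _ _ hab)

/-- A weighted graph with a pair of non-adjacent distinct vertices has a nonconstant generalized
eigenvector of `(D - W, D)` with eigenvalue at most one. -/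
theorem exists_nonconstant_eigenvector_le_one {ι : Type*} [Fintype ι] [DecidableEq ι]
    {W : Matrix ι ι ℝ} (hsymm : W.IsSymm) (hdiag : ∀ i, W i i = 0)
    (hdeg : ∀ i, 0 < ∑ j, W i j) {p q : ι} (hpq : p ≠ q) (hW : W p q = 0) :
    ∃ (μ : ℝ) (x : ι → ℝ), μ ≤ 1 ∧
      (∀ i, (∑ j, W i j) * x i - ∑ j, W i j * x j = μ * ((∑ j, W i j) * x i)) ∧
      ¬ ∃ c : ℝ, x = fun _ => c := by
  set s : ι → ℝ := fun i => √(∑ j, W i j)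
  have hspos (i : ι) : 0 < s i := Real.sqrt_pos.2 (hdeg i)
  have hsq (i : ι) : ∑ j, W i j = s i * s i := (Real.mul_self_sqrt (hdeg i).le).symm
  let A : Matrix ι ι ℝ := Matrix.of fun i j => W i j / (s i * s j)
  have hA : A.IsHermitian := by
    ext i j
    simp [A, hsymm.apply, mul_comm]
  let y : ι → ℝ := Pi.single p (s q) - Pi.single q (s p)
  have hy : y ≠ 0 := fun h => by
    have := congrFun h p
    simp [y, hpq, (hspos q).ne'] at this
  have hWqp : W q p = 0 := by rw [hsymm.apply, hW]
  have hquad : y ⬝ᵥ A *ᵥ y = 0 := by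
    simp [y, A, Matrix.mulVec_sub, sub_dotProduct, hW, hWqp, hdiag]
  obtain ⟨ν, v, hν, hv, hvy⟩ := hA.exists_nonneg_eigenvalue_dotProduct_ne_zero hy hquad.ge
  refine ⟨1 - ν, fun i => v i / s i, by linarith, fun i => ?_, ?_⟩
  · have hi : ∑ j, W i j / (s i * s j) * v j = ν * v i := by
      simpa [A, Matrix.mulVec, dotProduct] using congrFun hv i
    have hsum : ∑ j, W i j * (v j / s j) = s i * (ν * v i) := by
      rw [← hi, Finset.mul_sum]
      refine Finset.sum_congr rfl fun j _ => ?_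
      have := (hspos i).ne'
      have := (hspos j).ne'
      field_simp
    rw [hsum, hsq]
    have := (hspos i).ne'
    field_simp
  · rintro ⟨c, hc⟩
    have hvc (i : ι) : v i = c * s i := (div_eq_iff (hspos i).ne').1 (congrFun hc i)
    apply hvy
    simp only [y, dotProduct_sub, dotProduct_single, hvc]
    ring

theorem mutually_reinforcing_model_solutions {n : ℕ}
    (W : Matrix (Fin n) (Fin n) ℝ)
    (hsymm : W.IsSymm)
    (hnn : ∀ i j, 0 ≤ W i j)
    (hdiag : ∀ i, W i i = 0)
    (hconn : IsConnectedGraph W)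
    (hdeg : ∀ i, 0 < ∑ j, W i j)
    (D : Matrix (Fin n) (Fin n) ℝ) (hD : D = Matrix.diagonal (fun i => ∑ j, W i j))
    (L : Matrix (Fin n) (Fin n) ℝ) (hL : L = D - W) :
    -- the solutions of the mutually reinforcing model are exactly the
    -- generalized eigen-pairs of the pencil (L, D):
    (∀ (μ : ℝ) (x : Fin n → ℝ), x ≠ 0 →
      (x = μ • x + (D⁻¹ * W).mulVec x ↔ L.mulVec x = μ • D.mulVec x)) ∧
    -- the solutions with μ = 0 are exactly the nonzero scalar multiples of 𝟙:
    (∀ x : Fin n → ℝ, x ≠ 0 →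
      (x = (0 : ℝ) • x + (D⁻¹ * W).mulVec x ↔
        ∃ c : ℝ, c ≠ 0 ∧ x = fun _ => c)) ∧
    -- if the graph is not complete, there is a solution with 0 < μ ≤ 1 whose
    -- vector is not a scalar multiple of 𝟙:
    ((∃ i j : Fin n, i ≠ j ∧ W i j = 0) →
      ∃ (μ : ℝ) (x : Fin n → ℝ), x ≠ 0 ∧ 0 < μ ∧ μ ≤ 1 ∧
        x = μ • x + (D⁻¹ * W).mulVec x ∧ ¬ ∃ c : ℝ, x = fun _ => c) := by
  have hmodel (μ : ℝ) (x : Fin n → ℝ) : x = μ • x + (D⁻¹ * W).mulVec x ↔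
      ∀ i, (∑ j, W i j) * x i - ∑ j, W i j * x j = μ * ((∑ j, W i j) * x i) := by
    have hinv : D⁻¹ = Matrix.diagonal fun i => (∑ j, W i j)⁻¹ := by
      rw [hD]
      refine Matrix.inv_eq_right_inv ?_
      simp [Matrix.diagonal_mul_diagonal, (hdeg _).ne']
    rw [hinv, ← Matrix.mulVec_mulVec, funext_iff]
    refine forall_congr' fun i => ?_
    have hi := (hdeg i).ne'
    simp only [Pi.add_apply, Pi.smul_apply, smul_eq_mul, Matrix.mulVec_diagonal]
    rw [show (W *ᵥ x) i = ∑ j, W i j * x j from rfl]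
    constructor
    · intro h
      field_simp at h
      linarith
    · intro h
      field_simp
      linarith
  have hpencil (μ : ℝ) (x : Fin n → ℝ) : L.mulVec x = μ • D.mulVec x ↔
      ∀ i, (∑ j, W i j) * x i - ∑ j, W i j * x j = μ * ((∑ j, W i j) * x i) := by
    rw [hL, hD, funext_iff]
    refine forall_congr' fun i => ?_
    simp only [Matrix.sub_mulVec, Pi.sub_apply, Pi.smul_apply, smul_eq_mul,
      Matrix.mulVec_diagonal]
    rfl
  have henergy (μ : ℝ) (x : Fin n → ℝ)
      (h : ∀ i, (∑ j, W i j) * x i - ∑ j, W i j * x j = μ * ((∑ j, W i j) * x i)) :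
      ∑ i, ∑ j, W i j * (x i - x j) ^ 2 = 2 * (μ * ∑ i, (∑ j, W i j) * x i ^ 2) := by
    rw [sum_weight_mul_sub_sq hsymm, Finset.mul_sum (a := μ)]
    congr 1
    refine Finset.sum_congr rfl fun i _ => ?_
    rw [h]
    ring
  refine ⟨fun μ x _ => (hmodel μ x).trans (hpencil μ x).symm, fun x hx => ?_, ?_⟩
  · rw [hmodel]
    constructor
    · intro h
      obtain ⟨i, hi⟩ := Function.ne_iff.1 hx
      exact ⟨x i, hi, funext fun j =>
        hconn.eq_of_energy_eq_zero hnn (by simpa using henergy 0 x h) j i⟩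
    · rintro ⟨c, _, rfl⟩ i
      simp [Finset.sum_mul]
  · rintro ⟨p, q, hpq, hW⟩
    obtain ⟨μ, x, hμ, hx, hconst⟩ :=
      exists_nonconstant_eigenvector_le_one hsymm hdiag hdeg hpq hW
    refine ⟨μ, x, fun h => hconst ⟨0, h⟩, ?_, hμ, (hmodel μ x).2 hx, hconst⟩
    by_contra! hμ0
    have hE := henergy μ x hx
    have hnonneg : 0 ≤ ∑ i, (∑ j, W i j) * x i ^ 2 :=
      Finset.sum_nonneg fun i _ => mul_nonneg (hdeg i).le (sq_nonneg _)
    have hE0 : 0 ≤ ∑ i, ∑ j, W i j * (x i - x j) ^ 2 :=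
      Finset.sum_nonneg fun i _ => Finset.sum_nonneg fun j _ =>
        mul_nonneg (hnn i j) (sq_nonneg _)
    exact hconst ⟨x p, funext fun j => hconn.eq_of_energy_eq_zero hnn
      (le_antisymm (by nlinarith) hE0) j p⟩
end
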